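/- arXiv:1206.3193 — 2 statements merged into one kernel-verified Lean document; each statement's English description precedes it below -/
import Mathlib

section
/- Let vw be an edge of T_{L,d} with v ∈ E and w ∈ O, and let A ⊆ E, B ⊆ O be sets with no edge of T_{L,d} joining A and B, with v ∉ A and w ∉ B. Then |∂v ∩ B| + |∂w ∩ A| ≤ 2d, i.e., the number of neighbors of v lying in B plus the number of neighbors of w lying in A is at most 2d. -/
open Finset

/-- Vertices of the discrete torus `T_{L,d}`: functions from `Fin d` to `Fin L`. -/
abbrev TV (L d : ℕ) : Type := Fin d → Fin L

/-- Adjacency in the discrete torus `T_{L,d}`: `x` and `y` differ in exactly one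
coordinate, and differ by `1 (mod L)` in that coordinate. -/
def TorusAdj {L d : ℕ} (x y : TV L d) : Prop :=
  ∃ i : Fin d, x i ≠ y i ∧
    ((y i : ℕ) = ((x i : ℕ) + 1) % L ∨ (x i : ℕ) = ((y i : ℕ) + 1) % L) ∧
    ∀ j : Fin d, j ≠ i → x j = y j

instance {L d : ℕ} (x y : TV L d) : Decidable (TorusAdj x y) := by
  unfold TorusAdj; infer_instance

/-- A vertex of the torus is even if its coordinate sum is even. -/
def IsEvenVtx {L d : ℕ} (x : TV L d) : Prop := (∑ i, (x i : ℕ)) % 2 = 0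

instance {L d : ℕ} (x : TV L d) : Decidable (IsEvenVtx x) := by
  unfold IsEvenVtx; infer_instance

/-- Proper 3-colorings of `T_{L,d}`. -/
def ProperColoring (L d : ℕ) (χ : TV L d → Fin 3) : Prop :=
  ∀ x y : TV L d, TorusAdj x y → χ x ≠ χ y

instance (L d : ℕ) : DecidablePred (ProperColoring L d) := by
  intro χ; unfold ProperColoring; infer_instance

/-- The set (as a type) of proper 3-colorings of `T_{L,d}`. -/
abbrev Coloring3 (L d : ℕ) : Type := {χ : TV L d → Fin 3 // ProperColoring L d χ}

/-- `|χ⁻¹(0) ∩ E|`: the number of even vertices colored 0. -/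
noncomputable def zeroEvenCount (L d : ℕ) (χ : TV L d → Fin 3) : ℕ :=
  Nat.card {v : TV L d // χ v = 0 ∧ IsEvenVtx v}

/-- `|χ⁻¹(0) ∩ O|`: the number of odd vertices colored 0. -/
noncomputable def zeroOddCount (L d : ℕ) (χ : TV L d → Fin 3) : ℕ :=
  Nat.card {v : TV L d // χ v = 0 ∧ ¬ IsEvenVtx v}

/-- Balanced colorings: `||χ⁻¹(0)∩E| - |χ⁻¹(0)∩O|| ≤ ρ L^d / 2`. -/
def BalancedColoring (L d : ℕ) (ρ : ℝ) (χ : TV L d → Fin 3) : Prop :=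
  |(zeroEvenCount L d χ : ℝ) - (zeroOddCount L d χ : ℝ)| ≤ ρ * (L : ℝ) ^ d / 2

/-- Colorings where color 0 predominates on the even sublattice:
`|χ⁻¹(0)∩E| > |χ⁻¹(0)∩O| + ρ L^d / 2`. -/
def EvenMajorityColoring (L d : ℕ) (ρ : ℝ) (χ : TV L d → Fin 3) : Prop :=
  (zeroOddCount L d χ : ℝ) + ρ * (L : ℝ) ^ d / 2 < (zeroEvenCount L d χ : ℝ)

/-- The uniform measure, on proper 3-colorings of `T_{L,d}`, of the set of proper
3-colorings satisfying the predicate `P`. -/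
noncomputable def pi3 (L d : ℕ) (P : (TV L d → Fin 3) → Prop) : ℝ :=
  (Nat.card {χ : TV L d → Fin 3 // ProperColoring L d χ ∧ P χ} : ℝ) /
    (Nat.card (Coloring3 L d) : ℝ)

/-- The binary entropy function `H(x) = -x log₂ x - (1-x) log₂ (1-x)`. -/
noncomputable def binEntropy (x : ℝ) : ℝ :=
  -(x * Real.logb 2 x) - (1 - x) * Real.logb 2 (1 - x)

/-- The `2 * d` unit steps of the torus, indexed by a direction and a sign. -/
def torusStep (L d : ℕ) [NeZero L] (p : Fin d × Bool) : TV L d :=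
  Pi.single p.1 (if p.2 then 1 else -1)

theorem Fin.val_eq_val_add_one_mod_iff {L : ℕ} [NeZero L] (a b : Fin L) :
    (b : ℕ) = ((a : ℕ) + 1) % L ↔ b = a + 1 := by
  rw [Fin.ext_iff, Fin.val_add, Fin.val_one', Nat.add_mod_mod]

theorem torusAdj_iff_exists_torusStep {L d : ℕ} [NeZero L] (hL : 2 ≤ L) (x y : TV L d) :
    TorusAdj x y ↔ ∃ p, y - x = torusStep L d p := by
  simp only [TorusAdj, Fin.val_eq_val_add_one_mod_iff]
  constructor
  · rintro ⟨i, -, h, hj⟩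
    have key (c : Fin L) (hc : y i - x i = c) : y - x = Pi.single i c := by
      ext1 j
      rcases eq_or_ne j i with rfl | hji
      · simpa using hc
      · simp [hji, hj j hji]
    rcases h with h | h
    · exact ⟨(i, true), key _ (by simp [h])⟩
    · exact ⟨(i, false), key _ (by simp [h])⟩
  · rintro ⟨⟨i, s⟩, h⟩
    have hi : y i - x i = if s then 1 else -1 := by
      simpa [torusStep] using congrFun h i
    refine ⟨i, fun hxy => ?_, ?_, fun j hj => ?_⟩
    · cases s <;> simp [hxy] at hi <;> omega
    · cases s
      · right
        simp only [Bool.false_eq_true, if_false] at hi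
        rw [sub_eq_iff_eq_add.mp hi]
        abel
      · left
        simp only [if_true] at hi
        rw [sub_eq_iff_eq_add.mp hi, add_comm]
    · have := congrFun h j
      simp only [torusStep, Pi.sub_apply, Pi.single_eq_of_ne hj] at this
      exact (sub_eq_zero.mp this).symm

theorem TorusAdj.symm {L d : ℕ} {x y : TV L d} (h : TorusAdj x y) : TorusAdj y x := by
  obtain ⟨i, hne, h, hj⟩ := h
  exact ⟨i, hne.symm, h.symm, fun j hji => (hj j hji).symm⟩

open Classical in
theorem card_torusAdj_mem_le {L d : ℕ} [NeZero L] (hL : 2 ≤ L) (x : TV L d) (S : Set (TV L d)) :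
    Nat.card {u : TV L d // TorusAdj x u ∧ u ∈ S} ≤
      #{p : Fin d × Bool | x + torusStep L d p ∈ S} := by
  rw [Nat.card_eq_fintype_card, Fintype.card_subtype]
  refine (card_le_card fun u hu => ?_).trans (card_image_le (f := fun p => x + torusStep L d p))
  obtain ⟨hxu, huS⟩ := (mem_filter.mp hu).2
  obtain ⟨p, hp⟩ := (torusAdj_iff_exists_torusStep hL x u).mp hxu
  have hu' : x + torusStep L d p = u := by rw [← hp, add_sub_cancel]
  exact mem_image.mpr ⟨p, by simpa [hu'] using huS, hu'⟩

/-- for an edge `vw` with `v ∈ E ∖ A`, `w ∈ O ∖ B`, where `A ⊆ E`,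
`B ⊆ O` and no edge joins `A` and `B`, the number of neighbours of `v` in `B` plus the
number of neighbours of `w` in `A` is at most `2d`. -/
theorem edge_neighbor_count_bound (L d : ℕ) (hL : Even L) (hL4 : 4 ≤ L)
    (v w : TV L d) (hvw : TorusAdj v w) (hv : IsEvenVtx v) (hw : ¬ IsEvenVtx w)
    (A B : Set (TV L d))
    (hA : ∀ a ∈ A, IsEvenVtx a) (hB : ∀ b ∈ B, ¬ IsEvenVtx b)
    (hAB : ∀ a ∈ A, ∀ b ∈ B, ¬ TorusAdj a b)
    (hvA : v ∉ A) (hwB : w ∉ B) :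
    Nat.card {u : TV L d // TorusAdj v u ∧ u ∈ B} +
        Nat.card {u : TV L d // TorusAdj w u ∧ u ∈ A} ≤ 2 * d := by
  classical
  have : NeZero L := ⟨by omega⟩
  have hL2 : 2 ≤ L := by omega
  refine (add_le_add (card_torusAdj_mem_le hL2 v B) (card_torusAdj_mem_le hL2 w A)).trans ?_
  rw [← card_union_of_disjoint]
  · refine (card_le_univ _).trans ?_
    simp [mul_comm]
  · rw [disjoint_filter]
    intro p _ hpB hpA
    refine hAB _ hpA _ hpB (TorusAdj.symm ?_)
    rw [torusAdj_iff_exists_torusStep hL2] at hvw ⊢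
    simpa using hvw
end

section
/- Let χ be a proper 3-coloring of T_{L,d} and let W ⊆ V satisfy ∂_int W ⊆ O, ∂_ext W ⊆ E, and χ⁻¹(0) ∩ (∂_int W ∪ ∂_ext W) = ∅. Then for every direction s ∈ {±1,…,±d} and every subset S ⊆ W^s, the map χ^s_S is a proper 3-coloring of T_{L,d}. -/
open Finset

/-- External vertex boundary `∂_ext X`. -/
def extBdry {L d : ℕ} (X : Set (TV L d)) : Set (TV L d) :=
  {y | y ∉ X ∧ ∃ x ∈ X, TorusAdj y x}

/-- Internal vertex boundary `∂_int X`. -/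
def intBdry {L d : ℕ} (X : Set (TV L d)) : Set (TV L d) :=
  {x | x ∈ X ∧ ∃ y, y ∉ X ∧ TorusAdj x y}

/-- The even part `W ∩ E`. -/
def evenPart {L d : ℕ} (W : Set (TV L d)) : Set (TV L d) := {v ∈ W | IsEvenVtx v}

/-- The odd part `W ∩ O`. -/
def oddPart {L d : ℕ} (W : Set (TV L d)) : Set (TV L d) := {v ∈ W | ¬ IsEvenVtx v}

/-- The size `|∇(W)|` of the edge boundary of `W`: each boundary edge is counted once,
as the ordered pair whose first coordinate is inside `W`. -/
noncomputable def cutsetCard (L d : ℕ) (W : Set (TV L d)) : ℕ :=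
  Nat.card {p : TV L d × TV L d // p.1 ∈ W ∧ p.2 ∉ W ∧ TorusAdj p.1 p.2}

/-- Add one (mod `L`) in `Fin L`. -/
def fSucc {L : ℕ} (a : Fin L) : Fin L :=
  ⟨((a : ℕ) + 1) % L, Nat.mod_lt _ (Nat.lt_of_le_of_lt (Nat.zero_le _) a.isLt)⟩

/-- Subtract one (mod `L`) in `Fin L`. -/
def fPred {L : ℕ} (a : Fin L) : Fin L :=
  ⟨((a : ℕ) + (L - 1)) % L, Nat.mod_lt _ (Nat.lt_of_le_of_lt (Nat.zero_le _) a.isLt)⟩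

/-- The shift `σ_s` in direction `s`: a direction is a coordinate `s.1` together with
a sign `s.2` (`true` is the positive direction). -/
def dirShift {L d : ℕ} (s : Fin d × Bool) (x : TV L d) : TV L d :=
  fun j => if j = s.1 then (if s.2 then fSucc (x j) else fPred (x j)) else x j

/-- The direction `-s`. -/
def negDir {d : ℕ} (s : Fin d × Bool) : Fin d × Bool := (s.1, !s.2)

/-- `W^s = {x ∈ ∂_int W : σ_{-s}(x) ∉ W}`. -/
def sideSet {L d : ℕ} (W : Set (TV L d)) (s : Fin d × Bool) : Set (TV L d) :=
  {x | x ∈ intBdry W ∧ dirShift (negDir s) x ∉ W}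

/-- The map `f` on colors fixing `0` and transposing `1` and `2`. -/
def colorSwap : Fin 3 → Fin 3 := fun c => if c = 1 then 2 else if c = 2 then 1 else 0

open Classical in
/-- The modified coloring `χ^s_S`: equal to `0` on `S`, to `χ` on `(W^s ∖ S) ∪ (V ∖ W)`,
and to `f(χ(σ_{-s}(v)))` on `W ∖ W^s`. -/
noncomputable def shiftedColoring (L d : ℕ) (χ : TV L d → Fin 3) (W : Set (TV L d))
    (s : Fin d × Bool) (S : Set (TV L d)) : TV L d → Fin 3 :=
  fun v =>
    if v ∈ S then 0
    else if v ∈ W ∧ v ∉ sideSet W s then colorSwap (χ (dirShift (negDir s) v))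
    else χ v

theorem fSucc_val {L : ℕ} (a : Fin L) :
    (fSucc a : ℕ) = if (a : ℕ) + 1 = L then 0 else (a : ℕ) + 1 := by
  have ha := a.isLt
  unfold fSucc
  split_ifs with h
  · simp [h]
  · exact Nat.mod_eq_of_lt (by omega)

theorem fPred_val {L : ℕ} (a : Fin L) :
    (fPred a : ℕ) = if (a : ℕ) = 0 then L - 1 else (a : ℕ) - 1 := by
  have ha := a.isLt
  unfold fPred
  split_ifs with h
  · simp [h]
  · have e : (a : ℕ) + (L - 1) = ((a : ℕ) - 1) + L := by omega
    simpa [e] using Nat.mod_eq_of_lt (by omega : (a : ℕ) - 1 < L)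

theorem fPred_fSucc {L : ℕ} (a : Fin L) : fPred (fSucc a) = a := by
  have ha := a.isLt
  ext
  rw [fPred_val, fSucc_val]
  grind

theorem fSucc_fPred {L : ℕ} (a : Fin L) : fSucc (fPred a) = a := by
  have ha := a.isLt
  ext
  rw [fSucc_val, fPred_val]
  grind

theorem fSucc_ne {L : ℕ} (hL : 2 ≤ L) (a : Fin L) : fSucc a ≠ a := by
  intro h
  have h' := congrArg Fin.val h
  rw [fSucc_val] at h'
  split_ifs at h' <;> omega

/-- Adjacency expressed through the cyclic successor. -/
theorem torusAdj_iff {L d : ℕ} {x y : TV L d} :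
    TorusAdj x y ↔ ∃ i, x i ≠ y i ∧ (y i = fSucc (x i) ∨ x i = fSucc (y i)) ∧
      ∀ j, j ≠ i → x j = y j := by
  simp only [TorusAdj, Fin.ext_iff, fSucc]

theorem torusAdj_dirShift {L d : ℕ} (hL : 2 ≤ L) (s : Fin d × Bool) (x : TV L d) :
    TorusAdj x (dirShift s x) := by
  obtain ⟨i, b⟩ := s
  refine torusAdj_iff.2 ⟨i, ?_, ?_, fun j hj => by simp [dirShift, hj]⟩
  · cases b
    · intro h
      simp only [dirShift, if_true, Bool.false_eq_true, if_false] at h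
      exact fSucc_ne hL (x i) (by rw [h, fSucc_fPred, ← h])
    · simpa [dirShift] using (fSucc_ne hL (x i)).symm
  · cases b <;> simp [dirShift, fSucc_fPred]

theorem TorusAdj.dirShift {L d : ℕ} {x y : TV L d} (h : TorusAdj x y) (s : Fin d × Bool) :
    TorusAdj (dirShift s x) (dirShift s y) := by
  obtain ⟨i, hne, hi, hj⟩ := torusAdj_iff.1 h
  refine torusAdj_iff.2 ⟨i, ?_, ?_, fun j hji => by simp [_root_.dirShift, hj j hji]⟩
  · simp only [_root_.dirShift]
    split_ifs
    · exact fun e => hne (by simpa only [fPred_fSucc] using congrArg fPred e)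
    · exact fun e => hne (by simpa only [fSucc_fPred] using congrArg fSucc e)
    · exact hne
  · simp only [_root_.dirShift]
    split_ifs
    · exact hi.imp (congrArg _) (congrArg _)
    · rcases hi with e | e <;> simp [e, fPred_fSucc, fSucc_fPred]
    · exact hi

/-- For even `L` the torus is bipartite. -/
theorem TorusAdj.isEvenVtx {L d : ℕ} (hL : Even L) {x y : TV L d} (h : TorusAdj x y)
    (hx : ¬ IsEvenVtx x) : IsEvenVtx y := by
  obtain ⟨i, -, hi, hj⟩ := torusAdj_iff.1 h
  have hsum : ∑ j ∈ univ.erase i, (x j : ℕ) = ∑ j ∈ univ.erase i, (y j : ℕ) :=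
    sum_congr rfl fun j hji => by rw [hj j (ne_of_mem_erase hji)]
  have hxi := add_sum_erase univ (fun j => (x j : ℕ)) (mem_univ i)
  have hyi := add_sum_erase univ (fun j => (y j : ℕ)) (mem_univ i)
  obtain ⟨k, hk⟩ := hL
  unfold IsEvenVtx at hx ⊢
  have hpar : ((x i : ℕ) + (y i : ℕ)) % 2 = 1 := by
    rcases hi with e | e <;> rw [e, fSucc_val] <;> split_ifs <;> omega
  omega

theorem colorSwap_injective : Function.Injective colorSwap := by decide

theorem colorSwap_ne_zero {c : Fin 3} : c ≠ 0 → colorSwap c ≠ 0 := by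
  revert c; decide

theorem colorSwap_ne_of_common_neighbor {a b c : Fin 3} :
    a ≠ 0 → b ≠ 0 → c ≠ 0 → a ≠ c → b ≠ c → colorSwap b ≠ a := by
  revert a b c; decide

theorem colorSwap_ne_of_ne {a b c : Fin 3} :
    a ≠ 0 → c ≠ 0 → a ≠ c → b ≠ c → colorSwap b ≠ a := by
  revert a b c; decide

/-- Claim 4.1: the shifted colorings `χ^s_S` are proper 3-colorings. -/
theorem shiftedColoring_proper (L d : ℕ) (hL : Even L) (hL4 : 4 ≤ L)
    (χ : TV L d → Fin 3) (hχ : ProperColoring L d χ) (W : Set (TV L d))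
    (h1 : ∀ x ∈ intBdry W, ¬ IsEvenVtx x)
    (h2 : ∀ x ∈ extBdry W, IsEvenVtx x)
    (h3 : ∀ x ∈ intBdry W ∪ extBdry W, χ x ≠ 0)
    (s : Fin d × Bool) (S : Set (TV L d)) (hS : S ⊆ sideSet W s) :
    ProperColoring L d (shiftedColoring L d χ W s S) := by
  have hL2 : 2 ≤ L := by omega
  set τ : TV L d → TV L d := dirShift (negDir s)
  have adj_τ : ∀ x, TorusAdj x (τ x) := torusAdj_dirShift hL2 _
  have adj_ττ : ∀ x y, TorusAdj x y → TorusAdj (τ x) (τ y) := fun _ _ h => h.dirShift _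
  have ne_zero_inner : ∀ x y, x ∈ W → y ∉ W → TorusAdj x y → χ x ≠ 0 :=
    fun x y hx hy h => h3 x (Or.inl ⟨hx, y, hy, h⟩)
  have ne_zero_outer : ∀ x y, x ∈ W → y ∉ W → TorusAdj x y → χ y ≠ 0 :=
    fun x y hx hy h => h3 y (Or.inr ⟨hy, x, hx, h.symm⟩)
  have hτW : ∀ y, y ∈ W → y ∉ sideSet W s → τ y ∈ W := fun y hy hys => by
    by_contra hc
    exact hys ⟨⟨hy, τ y, hc, adj_τ y⟩, hc⟩
  have heven : ∀ x y, x ∈ sideSet W s → TorusAdj x y → y ∉ sideSet W s :=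
    fun x y hx h hy => h1 y hy.1 (h.isEvenVtx hL (h1 x hx.1))
  -- The color `0` placed on `S` does not conflict with a neighbor.
  have key0 : ∀ x y, TorusAdj x y → x ∈ S →
      shiftedColoring L d χ W s S x ≠ shiftedColoring L d χ W s S y := by
    intro x y h hxS
    have hx := hS hxS
    have hys := heven x y hx h
    have hyS : y ∉ S := fun hy => hys (hS hy)
    simp only [shiftedColoring, hxS, hyS, if_true, if_false]
    split_ifs with hyW
    · exact (colorSwap_ne_zero
        (ne_zero_inner (τ y) (τ x) (hτW y hyW.1 hys) hx.2 (adj_ττ x y h).symm)).symm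
    · exact (ne_zero_outer x y hx.1.1 (fun hc => hyW ⟨hc, hys⟩) h).symm
  -- An unshifted vertex does not conflict with a shifted one.
  have key1 : ∀ x y, TorusAdj x y → ¬ (x ∈ W ∧ x ∉ sideSet W s) → y ∈ W → y ∉ sideSet W s →
      colorSwap (χ (τ y)) ≠ χ x := by
    intro x y h hx hyW hys
    have hτy := hτW y hyW hys
    by_cases hxW : x ∈ W
    · have hxs : x ∈ sideSet W s := by_contra fun hc => hx ⟨hxW, hc⟩
      have hadj := (adj_ττ x y h).symm
      exact colorSwap_ne_of_common_neighbor (ne_zero_inner x _ hxW hxs.2 (adj_τ x))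
        (ne_zero_inner _ _ hτy hxs.2 hadj) (ne_zero_outer _ _ hxW hxs.2 (adj_τ x))
        (hχ _ _ (adj_τ x)) (hχ _ _ hadj)
    · exact colorSwap_ne_of_ne (ne_zero_outer y x hyW hxW h.symm) (ne_zero_inner y x hyW hxW h.symm)
        (hχ x y h) (hχ _ _ (adj_τ y).symm)
  intro x y h
  by_cases hxS : x ∈ S
  · exact key0 x y h hxS
  by_cases hyS : y ∈ S
  · exact (key0 y x h.symm hyS).symm
  simp only [shiftedColoring, hxS, hyS, if_false]
  split_ifs with hx hy hy
  · exact fun e => hχ _ _ (adj_ττ x y h) (colorSwap_injective e)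
  · exact key1 y x h.symm hy hx.1 hx.2
  · exact (key1 x y h hx hy.1 hy.2).symm
  · exact hχ x y h
end
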